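/- Correctness of the rotation test in the real case: Let N ≥ 1, α ∈ (0, π/2), and let l, u : {0,…,N} → ℝ with l n ≤ u n for all n. Define rotated interval bounds Lc n = lo(cos(nα), l n, u n), Uc n = hi(cos(nα), l n, u n), Ld n = lo(sin(nα), l n, u n), Ud n = hi(sin(nα), l n, u n) (these enclose the real and imaginary parts of e^{inα} a_n). Assume: (1) every member polynomial P_a(s) = Σ_{n=0}^N a_n s^n with l n ≤ a_n ≤ u n (viewed in ℂ[s]) is Hurwitz, and (2) every complex polynomial Σ_{n=0}^N (c_n + i d_n) s^n with Lc n ≤ c_n ≤ Uc n and Ld n ≤ d_n ≤ Ud n is Hurwitz. Then for every member P_a of the real family and every complex root z of P_a, arg(−z) ∈ (α − π/2, π/2 − α); i.e. the symmetric sector {s : π/2 + α ≤ angle(s) ≤ 3π/2 − α} is a containing sector for the real interval polynomial family. -/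

import Mathlib

open Polynomial

/-- The member polynomial `∑ (c n + i d n) s^n` of a complex interval family. -/
noncomputable def member (N : ℕ) (c d : ℕ → ℝ) : Polynomial ℂ :=
  ∑ n ∈ Finset.range (N + 1), C ((c n : ℂ) + (d n : ℂ) * Complex.I) * X ^ n

/-- The member polynomial `∑ a_n s^n` of a real interval family, viewed in `ℂ[s]`. -/
noncomputable def rmember (N : ℕ) (a : ℕ → ℝ) : Polynomial ℂ :=
  ∑ n ∈ Finset.range (N + 1), C ((a n : ℂ)) * X ^ n

/-- A polynomial is Hurwitz if it is nonzero and has no roots with nonnegative real part. -/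
def Hurwitz (P : Polynomial ℂ) : Prop :=
  P ≠ 0 ∧ ∀ z : ℂ, 0 ≤ z.re → P.eval z ≠ 0

/-- Lower endpoint of the interval `x·[p,q]` of interval arithmetic. -/
noncomputable def lo (x p q : ℝ) : ℝ := if 0 ≤ x then x * p else x * q

/-- Upper endpoint of the interval `x·[p,q]` of interval arithmetic. -/
noncomputable def hi (x p q : ℝ) : ℝ := if 0 ≤ x then x * q else x * p

theorem rmember_eval (N : ℕ) (a : ℕ → ℝ) (z : ℂ) :
    (rmember N a).eval z = ∑ n ∈ Finset.range (N + 1), (a n : ℂ) * z ^ n := by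
  simp [rmember, eval_finsetSum]

theorem rmember_eval_conj (N : ℕ) (a : ℕ → ℝ) (z : ℂ) :
    (rmember N a).eval (starRingEnd ℂ z) = starRingEnd ℂ ((rmember N a).eval z) := by
  simp [rmember_eval]

theorem member_cos_sin_eval (N : ℕ) (a : ℕ → ℝ) (α : ℝ) (z : ℂ) :
    (member N (fun n => Real.cos (n * α) * a n) (fun n => Real.sin (n * α) * a n)).eval z =
      (rmember N a).eval (Complex.exp (α * Complex.I) * z) := by
  rw [rmember_eval, member, eval_finsetSum]
  refine Finset.sum_congr rfl fun n _ => ?_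
  have h : Complex.exp (α * Complex.I) ^ n =
      Complex.cos (n * α) + Complex.sin (n * α) * Complex.I := by
    rw [← Complex.exp_nat_mul, ← Complex.exp_mul_I, mul_assoc]
  simp only [eval_mul, eval_C, eval_pow, eval_X, mul_pow, h]
  push_cast
  ring

theorem lo_le_mul_le_hi (x : ℝ) {p q y : ℝ} (hp : p ≤ y) (hq : y ≤ q) :
    lo x p q ≤ x * y ∧ x * y ≤ hi x p q := by
  unfold lo hi
  split_ifs with hx
  · exact ⟨mul_le_mul_of_nonneg_left hp hx, mul_le_mul_of_nonneg_left hq hx⟩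
  · have hx' : x ≤ 0 := (not_le.mp hx).le
    exact ⟨mul_le_mul_of_nonpos_left hq hx', mul_le_mul_of_nonpos_left hp hx'⟩

theorem re_exp_neg_mul_I_mul (α : ℝ) (y : ℂ) :
    (Complex.exp (-(α * Complex.I)) * y).re = ‖y‖ * Real.cos (y.arg - α) := by
  have h : Complex.exp (-(α * Complex.I)) * y =
      ‖y‖ * Complex.exp ((y.arg - α : ℝ) * Complex.I) := by
    conv_lhs => rw [← Complex.norm_mul_exp_arg_mul_I y]
    rw [mul_left_comm, ← Complex.exp_add]
    congr 2
    push_cast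
    ring
  rw [h, Complex.re_ofReal_mul, Complex.exp_ofReal_mul_I_re]

/-- A point of the open right half-plane that stays there after rotation by `-α` has
argument greater than `α - π / 2`. -/
theorem sub_pi_div_two_lt_arg {α : ℝ} (h0 : 0 < α) (hα : α < Real.pi / 2) {y : ℂ}
    (hy : 0 < y.re) (hrot : 0 < (Complex.exp (-(α * Complex.I)) * y).re) :
    α - Real.pi / 2 < y.arg := by
  by_contra! hle
  have harg := (abs_lt.mp (Complex.abs_arg_lt_pi_div_two_iff.mpr (Or.inl hy))).1
  have hcos : Real.cos (α - y.arg) ≤ 0 :=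
    Real.cos_nonpos_of_pi_div_two_le_of_le (by linarith) (by linarith)
  rw [re_exp_neg_mul_I_mul, ← Real.cos_neg, neg_sub] at hrot
  exact absurd hrot (not_lt.mpr (mul_nonpos_of_nonneg_of_nonpos (norm_nonneg y) hcos))

/-- Correctness of the rotation test in the real case: if the real family and the rotated
complex family (with interval coefficients enclosing `e^{inα} a_n`) are both robustly
Hurwitz, then every complex root `z` of every member of the real family satisfies
`arg (−z) ∈ (α − π/2, π/2 − α)`. -/
theorem rotation_test_real (N : ℕ) (hN : 1 ≤ N) (α : ℝ)
    (hα : 0 < α ∧ α < Real.pi / 2)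
    (l u : ℕ → ℝ) (hlu : ∀ n ≤ N, l n ≤ u n)
    (h1 : ∀ a : ℕ → ℝ, (∀ n ≤ N, l n ≤ a n ∧ a n ≤ u n) → Hurwitz (rmember N a))
    (h2 : ∀ c d : ℕ → ℝ,
      (∀ n ≤ N, lo (Real.cos (n * α)) (l n) (u n) ≤ c n ∧
        c n ≤ hi (Real.cos (n * α)) (l n) (u n)) →
      (∀ n ≤ N, lo (Real.sin (n * α)) (l n) (u n) ≤ d n ∧
        d n ≤ hi (Real.sin (n * α)) (l n) (u n)) →
      Hurwitz (member N c d)) :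
    ∀ a : ℕ → ℝ, (∀ n ≤ N, l n ≤ a n ∧ a n ≤ u n) →
      ∀ z : ℂ, (rmember N a).eval z = 0 →
        Complex.arg (-z) ∈ Set.Ioo (α - Real.pi / 2) (Real.pi / 2 - α) := by
  intro a ha
  have key : ∀ z : ℂ, (rmember N a).eval z = 0 →
      0 < (-z).re ∧ α - Real.pi / 2 < Complex.arg (-z) := by
    intro z hz
    have hre : 0 < (-z).re := by
      by_contra! hle
      exact (h1 a ha).2 z (by simpa using hle) hz
    refine ⟨hre, sub_pi_div_two_lt_arg hα.1 hα.2 hre ?_⟩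
    by_contra! hle
    refine (h2 _ _ (fun n hn => lo_le_mul_le_hi _ (ha n hn).1 (ha n hn).2)
      (fun n hn => lo_le_mul_le_hi _ (ha n hn).1 (ha n hn).2)).2
      (Complex.exp (-(α * Complex.I)) * z) ?_ ?_
    · rw [mul_neg, Complex.neg_re] at hle
      linarith
    · rw [member_cos_sin_eval, ← mul_assoc, ← Complex.exp_add, add_neg_cancel, Complex.exp_zero,
        one_mul, hz]
  intro z hz
  obtain ⟨hre, hlt⟩ := key z hz
  have hconj := (key (starRingEnd ℂ z) (by rw [rmember_eval_conj, hz, map_zero])).2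
  have hne : Complex.arg (-z) ≠ Real.pi := fun h => by
    have := Complex.arg_eq_pi_iff.mp h
    linarith [this.1]
  rw [← map_neg, Complex.arg_conj, if_neg hne] at hconj
  exact ⟨hlt, by linarith⟩
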